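/- If θ_1, θ_2 ∈ ℝ satisfy sin(θ_1)·sin(θ_2) > 0, then the 2×2 game (G^equil_1(θ_1), G^equil_2(θ_2)) is invariant-common-payoff: there exist a scale s_2 > 0 and offsets b_1 : Fin 2 → ℝ (a function of player 2's strategy) and b_2 : Fin 2 → ℝ (a function of player 1's strategy) such that for all (a_1, a_2) ∈ Fin 2 × Fin 2: G^equil_1(θ_1)(a_1,a_2) + b_1(a_2) = s_2·G^equil_2(θ_2)(a_1,a_2) + b_2(a_1). -/

import Mathlib

/-- Player 1's equilibrium-invariant embedding payoff for angle `θ`. -/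
noncomputable def Gequil1 (θ : ℝ) : Matrix (Fin 2) (Fin 2) ℝ :=
  !![Real.sin (θ + Real.pi / 4) / Real.sqrt 2, Real.cos (θ + Real.pi / 4) / Real.sqrt 2;
     -(Real.sin (θ + Real.pi / 4) / Real.sqrt 2), -(Real.cos (θ + Real.pi / 4) / Real.sqrt 2)]

/-- Player 2's equilibrium-invariant embedding payoff for angle `θ`. -/
noncomputable def Gequil2 (θ : ℝ) : Matrix (Fin 2) (Fin 2) ℝ :=
  !![Real.sin (θ + Real.pi / 4) / Real.sqrt 2, -(Real.sin (θ + Real.pi / 4) / Real.sqrt 2);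
     Real.cos (θ + Real.pi / 4) / Real.sqrt 2, -(Real.cos (θ + Real.pi / 4) / Real.sqrt 2)]

theorem Real.sin_add_pi_div_four_div_sqrt_two (θ : ℝ) :
    Real.sin (θ + Real.pi / 4) / Real.sqrt 2 = (Real.cos θ + Real.sin θ) / 2 := by
  rw [Real.sin_add, Real.sin_pi_div_four, Real.cos_pi_div_four]
  field_simp
  ring

theorem Real.cos_add_pi_div_four_div_sqrt_two (θ : ℝ) :
    Real.cos (θ + Real.pi / 4) / Real.sqrt 2 = (Real.cos θ - Real.sin θ) / 2 := by
  rw [Real.cos_add, Real.sin_pi_div_four, Real.cos_pi_div_four]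
  field_simp

/-- **Invariant-common-payoff quadrants.**
If `sin θ₁ · sin θ₂ > 0`, the game `(Gequil1 θ₁, Gequil2 θ₂)` is invariant-common-payoff. -/
theorem invariant_common_payoff_quadrants
    (θ1 θ2 : ℝ) (h : 0 < Real.sin θ1 * Real.sin θ2) :
    ∃ (s2 : ℝ) (b1 b2 : Fin 2 → ℝ),
      0 < s2 ∧
      ∀ a1 a2, Gequil1 θ1 a1 a2 + b1 a2 = s2 * Gequil2 θ2 a1 a2 + b2 a1 := by
  have hne : Real.sin θ2 ≠ 0 := right_ne_zero_of_mul h.ne'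
  refine ⟨Real.sin θ1 / Real.sin θ2,
    fun j => Real.sin θ1 / Real.sin θ2 * Gequil2 θ2 0 j - Gequil1 θ1 0 j,
    ![0, -Real.cos θ1], div_pos_iff.mpr (mul_pos_iff.mp h), fun a1 a2 => ?_⟩
  fin_cases a1 <;> fin_cases a2 <;>
    simp [Gequil1, Gequil2, Real.sin_add_pi_div_four_div_sqrt_two,
      Real.cos_add_pi_div_four_div_sqrt_two] <;>
    field_simp <;> ring
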